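/- Let n and f be natural numbers with 3*f < n, let H be a finite set of validators with |H| = n - f (the honest validators), let Checkpoint be any type, and let vote : Validator → Checkpoint be a function assigning to each honest validator its unique checkpoint vote target for a given epoch (an honest validator signs at most one attestation per epoch). Suppose C and C' are checkpoints such that the set {v ∈ H : vote v = C} satisfies 3*|{v ∈ H : vote v = C}| ≥ 2*n - 3*f and likewise 3*|{v ∈ H : vote v = C'}| ≥ 2*n - 3*f. Then C = C'. -/

import Mathlib

theorem unique_justified_checkpoint
    (n f : ℕ) (hnf : 3 * f < n)
    (Validator : Type) [DecidableEq Validator]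
    (H : Finset Validator)
    (hH : H.card = n - f)
    (Checkpoint : Type) [DecidableEq Checkpoint]
    (vote : Validator → Checkpoint)
    (C C' : Checkpoint)
    (hC : 3 * (H.filter (fun v => vote v = C)).card ≥ 2 * n - 3 * f)
    (hC' : 3 * (H.filter (fun v => vote v = C')).card ≥ 2 * n - 3 * f) :
    C = C' := by
  by_contra hne
  have hd : Disjoint (H.filter (fun v => vote v = C)) (H.filter (fun v => vote v = C')) := by
    rw [Finset.disjoint_left]
    intro v h1 h2
    exact hne ((Finset.mem_filter.mp h1).2.symm.trans (Finset.mem_filter.mp h2).2)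
  have hle := Finset.card_le_card (Finset.union_subset
    (Finset.filter_subset (fun v => vote v = C) H) (Finset.filter_subset (fun v => vote v = C') H))
  rw [Finset.card_union_of_disjoint hd] at hle
  omega
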